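/- Let H be a Pommaret basis of the proper nonzero homogeneous ideal I of P for the reverse lexicographic order and let H_1 = {h ∈ H : cls(lt(h)) = 1} be the subset of generators of class 1. Then the saturation satisfies I^sat = I : x_1^∞, and the ideal I is saturated (I = I^sat) if and only if H_1 = ∅. -/

import Mathlib

open MvPolynomial

/-- The (0-based) class of a nonzero exponent vector: the smallest index with
nonzero entry.  (The variables `x_1, …, x_n` of the paper are `X 0, …, X (n-1)`.) -/
noncomputable def cls {n : ℕ} (μ : Fin n →₀ ℕ) : ℕ :=
  sInf {i : ℕ | ∃ hi : i < n, μ ⟨i, hi⟩ ≠ 0}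

/-- `x^μ` involutively divides `x^ν` : it divides it and the quotient only involves
the multiplicative variables `x_1, …, x_{cls μ}` of `x^μ`. -/
def InvDiv {n : ℕ} (μ ν : Fin n →₀ ℕ) : Prop :=
  μ ≤ ν ∧ ∀ j : Fin n, ν j ≠ μ j → (j : ℕ) ≤ cls μ

/-- The exponent of the leading term of `f` with respect to the monomial order `m`. -/
noncomputable def ldeg {n : ℕ} {K : Type*} [Field K] (m : MonomialOrder (Fin n))
    (f : MvPolynomial (Fin n) K) : Fin n →₀ ℕ :=
  m.toSyn.symm (f.support.sup fun μ => m.toSyn μ)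

/-- The leading ideal `lt(I)` of an ideal `I` with respect to `m`. -/
noncomputable def ltIdeal {n : ℕ} {K : Type*} [Field K] (m : MonomialOrder (Fin n))
    (I : Ideal (MvPolynomial (Fin n) K)) : Ideal (MvPolynomial (Fin n) K) :=
  Ideal.span {g | ∃ f ∈ I, f ≠ 0 ∧ g = monomial (ldeg m f) (1 : K)}

/-- `H` is a (finite, monomial) Pommaret basis of the monomial ideal `I`:
it generates `I` and every monomial of `I` has a unique involutive divisor in `H`. -/
def IsMonPB {n : ℕ} {K : Type*} [Field K] (H : Set (Fin n →₀ ℕ))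
    (I : Ideal (MvPolynomial (Fin n) K)) : Prop :=
  H.Finite ∧ I = Ideal.span ((fun μ => monomial μ (1 : K)) '' H) ∧
    ∀ ν : Fin n →₀ ℕ, monomial ν (1 : K) ∈ I → ∃! μ, μ ∈ H ∧ InvDiv μ ν

/-- `H` is a Pommaret basis of the polynomial ideal `I` w.r.t. the monomial order `m`:
its elements lie in `I`, are nonzero with pairwise distinct leading terms, and the
leading terms form a Pommaret basis of the leading ideal. -/
def IsPB {n : ℕ} {K : Type*} [Field K] (m : MonomialOrder (Fin n))
    (H : Finset (MvPolynomial (Fin n) K)) (I : Ideal (MvPolynomial (Fin n) K)) : Prop :=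
  (∀ h ∈ H, h ∈ I) ∧ (∀ h ∈ H, h ≠ 0) ∧
    Set.InjOn (fun h : MvPolynomial (Fin n) K => ldeg m h) ↑H ∧
    IsMonPB ((fun h : MvPolynomial (Fin n) K => ldeg m h) '' ↑H) (ltIdeal m I)

/-- `m` is the degree reverse lexicographic order (with the reversed conventions of the
paper: for equal degrees, `μ ≺ ν` iff the first nonvanishing entry of `μ - ν` is positive). -/
def IsRevLex {n : ℕ} (m : MonomialOrder (Fin n)) : Prop :=
  ∀ μ ν : Fin n →₀ ℕ, m.toSyn μ < m.toSyn ν ↔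
    ((μ.sum fun _ e => e) < (ν.sum fun _ e => e) ∨
      ((μ.sum fun _ e => e) = (ν.sum fun _ e => e) ∧
        ∃ i : Fin n, ν i < μ i ∧ ∀ j : Fin n, j < i → μ j = ν j))

/-- `I` is a homogeneous ideal. -/
def IsHomIdeal {n : ℕ} {K : Type*} [Field K] (I : Ideal (MvPolynomial (Fin n) K)) : Prop :=
  ∃ S : Set (MvPolynomial (Fin n) K), (∀ f ∈ S, ∃ d, f.IsHomogeneous d) ∧ I = Ideal.span S

/-- The homogeneous maximal ideal `⟨x_1, …, x_n⟩`. -/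
noncomputable def mxI (n : ℕ) (K : Type*) [Field K] : Ideal (MvPolynomial (Fin n) K) :=
  Ideal.span (Set.range X)

/-- The saturation `I : ⟨x_1,…,x_n⟩^∞` of `I`, as a set. -/
def satSet {n : ℕ} {K : Type*} [Field K] (I : Ideal (MvPolynomial (Fin n) K)) :
    Set (MvPolynomial (Fin n) K) :=
  {f | ∃ s : ℕ, ∀ g ∈ (mxI n K ^ s : Ideal (MvPolynomial (Fin n) K)), g * f ∈ I}


theorem hom_mem {n : ℕ} {K : Type*} [Field K] {I : Ideal (MvPolynomial (Fin n) K)}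
    (hI : IsHomIdeal I) (d : ℕ) {f : MvPolynomial (Fin n) K} (hf : f ∈ I) :
    homogeneousComponent d f ∈ I := by
  obtain ⟨S, hS, rfl⟩ := hI
  let _ := MvPolynomial.gradedAlgebra (σ := Fin n) (R := K)
  have h := Ideal.homogeneous_span (homogeneousSubmodule (Fin n) K) S (by
    intro x hx
    obtain ⟨d, hd⟩ := hS x hx
    exact ⟨d, hd⟩)
  exact (mem_iff_homogeneousComponent_mem h f).1 hf d

theorem ldeg_eq {n : ℕ} {K : Type*} [Field K] (m : MonomialOrder (Fin n))
    (f : MvPolynomial (Fin n) K) : ldeg m f = m.degree f := rfl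

theorem mem_lt {n : ℕ} {K : Type*} [Field K] (m : MonomialOrder (Fin n))
    (I : Ideal (MvPolynomial (Fin n) K)) (ν : Fin n →₀ ℕ) :
    monomial ν (1 : K) ∈ ltIdeal m I ↔ ∃ f ∈ I, f ≠ 0 ∧ m.degree f = ν := by
  constructor
  · intro h
    have e : ltIdeal m I = Ideal.span ((fun s => monomial s (1 : K)) ''
        {s | ∃ f ∈ I, f ≠ 0 ∧ m.degree f = s}) := by
      unfold ltIdeal
      congr 1
      ext g
      constructor
      · rintro ⟨f, hf, h0, rfl⟩
        exact ⟨_, ⟨f, hf, h0, rfl⟩, rfl⟩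
      · rintro ⟨_, ⟨f, hf, h0, rfl⟩, rfl⟩
        exact ⟨f, hf, h0, rfl⟩
    rw [e, mem_ideal_span_monomial_image] at h
    obtain ⟨s, ⟨f, hf, h0, rfl⟩, hle⟩ := h ν (by classical simp [mem_support_iff])
    have hm : (monomial (ν - m.degree f) (1 : K)) ≠ 0 := by simp
    refine ⟨monomial (ν - m.degree f) 1 * f, I.mul_mem_left _ hf, mul_ne_zero hm h0, ?_⟩
    classical
    rw [m.degree_mul hm h0, m.degree_monomial, if_neg one_ne_zero]
    exact tsub_add_cancel_of_le hle
  · rintro ⟨f, hf, h0, rfl⟩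
    exact Ideal.subset_span ⟨f, hf, h0, rfl⟩

/-- the homogeneous part of `f` in the degree of its leading term -/
theorem lead_comp {n : ℕ} {K : Type*} [Field K] (m : MonomialOrder (Fin n))
    {f : MvPolynomial (Fin n) K} (h0 : f ≠ 0) :
    homogeneousComponent (m.degree f).degree f ≠ 0 ∧
    m.degree (homogeneousComponent (m.degree f).degree f) = m.degree f := by
  have hc : coeff (m.degree f) (homogeneousComponent (m.degree f).degree f) ≠ 0 := by
    rw [coeff_homogeneousComponent, if_pos rfl]
    exact m.coeff_degree_ne_zero_iff.2 h0
  refine ⟨fun h => hc (by rw [h]; simp), ?_⟩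
  apply m.toSyn.injective
  apply le_antisymm
  · apply m.degree_le_degree_of_support_subset
    intro ν hν
    rw [mem_support_iff, coeff_homogeneousComponent] at hν
    rw [mem_support_iff]
    intro h
    simp [h] at hν
  · exact m.le_degree (mem_support_iff.2 hc)

theorem key {n : ℕ} {K : Type*} [Field K] (i : Fin n) (m : MonomialOrder (Fin n))
    (I : Ideal (MvPolynomial (Fin n) K)) (hIhom : IsHomIdeal I) (D : ℕ)
    (hD : ∀ (ν : Fin n →₀ ℕ) (s : ℕ), D ≤ ν.degree →
      monomial (Finsupp.single i s + ν) (1 : K) ∈ ltIdeal m I →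
      monomial ν (1 : K) ∈ ltIdeal m I) (s : ℕ) :
    ∀ (a : m.syn) (f : MvPolynomial (Fin n) K), m.toSyn (m.degree f) = a →
      (∀ ν ∈ f.support, D ≤ ν.degree) → X i ^ s * f ∈ I → f ∈ I := by
  intro a
  induction a using WellFoundedLT.induction with
  | ind a ih =>
  intro f ha hf hX
  by_cases h0 : f = 0
  · rw [h0]; exact I.zero_mem
  have hdf : m.degree f ∈ f.support := m.degree_mem_support h0
  have hXm : (X i ^ s : MvPolynomial (Fin n) K) = monomial (Finsupp.single i s) 1 := by
    rw [X_pow_eq_monomial]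
  have hXne : (X i ^ s : MvPolynomial (Fin n) K) ≠ 0 := by rw [hXm]; simp
  have h1 : monomial (m.degree f) (1 : K) ∈ ltIdeal m I := by
    apply hD _ s (hf _ hdf)
    rw [mem_lt]
    refine ⟨_, hX, mul_ne_zero hXne h0, ?_⟩
    classical
    rw [m.degree_mul hXne h0, hXm, m.degree_monomial, if_neg one_ne_zero]
  rw [mem_lt] at h1
  obtain ⟨g', hg', hg'0, hg'd⟩ := h1
  obtain ⟨hg0, hgd⟩ := lead_comp m hg'0
  have hgI := hom_mem hIhom (m.degree g').degree hg'
  have hgs : ∀ ν ∈ (homogeneousComponent (m.degree g').degree g').support, D ≤ ν.degree := by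
    intro ν hν
    rw [mem_support_iff, coeff_homogeneousComponent] at hν
    have : ν.degree = (m.degree g').degree := by
      by_contra h
      simp [h] at hν
    rw [this, hg'd]
    exact hf _ hdf
  generalize homogeneousComponent (m.degree g').degree g' = g at *
  rw [hg'd] at hgd
  set c := m.leadingCoeff f / m.leadingCoeff g with hc
  have hcI : C c * g ∈ I := I.mul_mem_left _ hgI
  suffices h : f - C c * g ∈ I by simpa using I.add_mem h hcI
  by_cases hz : f - C c * g = 0
  · rw [hz]; exact I.zero_mem
  have hcd : coeff (m.degree f) (f - C c * g) = 0 := by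
    rw [coeff_sub, coeff_C_mul, hc]
    have h2 : coeff (m.degree f) g = m.leadingCoeff g := by rw [← hgd]; rfl
    rw [h2, div_mul_cancel₀ _ (m.leadingCoeff_ne_zero_iff.2 hg0)]
    exact sub_self _
  have hsup : ∀ ν ∈ (f - C c * g).support, ν ∈ f.support ∨ ν ∈ g.support := by
    intro ν hν
    by_contra! h
    simp only [mem_support_iff, not_not] at h
    rw [mem_support_iff, coeff_sub, coeff_C_mul, h.1, h.2] at hν
    simp at hν
  have hin := m.degree_mem_support hz
  refine ih (m.toSyn (m.degree (f - C c * g))) ?_ _ rfl ?_ ?_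
  · rw [← ha]
    apply lt_of_le_of_ne
    · rcases hsup _ hin with h | h
      · exact m.le_degree h
      · rw [← hgd]; exact m.le_degree h
    · intro h
      have := m.toSyn.injective h
      rw [this, mem_support_iff] at hin
      exact hin hcd
  · intro ν hν
    rcases hsup _ hν with h | h
    · exact hf _ h
    · exact hgs _ h
  · rw [mul_sub]
    exact I.sub_mem hX (I.mul_mem_left _ hcI)

theorem cls_zero {n : ℕ} (hn : 0 < n) {μ : Fin n →₀ ℕ} (h : cls μ ≠ 0) : μ ⟨0, hn⟩ = 0 := by
  by_contra h'
  exact h (Nat.sInf_eq_zero.2 (Or.inl ⟨hn, h'⟩))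

theorem step {n : ℕ} {K : Type*} [Field K] (hn : 0 < n) (m : MonomialOrder (Fin n))
    (I : Ideal (MvPolynomial (Fin n) K))
    (H : Finset (MvPolynomial (Fin n) K)) (hPB : IsPB m H I) (D : ℕ)
    (hD : ∀ h ∈ H, cls (ldeg m h) = 0 → (ldeg m h).degree ≤ D)
    (ν : Fin n →₀ ℕ) (s : ℕ) (hν : D ≤ ν.degree)
    (hs : monomial (Finsupp.single (⟨0, hn⟩ : Fin n) s + ν) (1 : K) ∈ ltIdeal m I) :
    monomial ν (1 : K) ∈ ltIdeal m I := by
  obtain ⟨hHI, hH0, -, -, hspan, hinv⟩ := hPB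
  obtain ⟨_, ⟨⟨h, hh, rfl⟩, hle, hj⟩, -⟩ := hinv _ hs
  simp only at hle hj
  suffices hle' : ldeg m h ≤ ν by
    rw [hspan, mem_ideal_span_monomial_image]
    intro ξ hξ
    have : ξ = ν := by
      classical
      simpa using (Finset.mem_singleton.1 (support_monomial_subset hξ))
    exact ⟨_, ⟨h, hh, rfl⟩, this ▸ hle'⟩
  by_cases hc : cls (ldeg m h) = 0
  · have heq : ∀ j : Fin n, j ≠ ⟨0, hn⟩ → ν j = ldeg m h j := by
      intro j hj0
      by_contra hne
      have := hj j (by simpa [Finsupp.single_apply, hj0.symm] using hne)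
      apply hj0
      ext
      simp
      omega
    have hdeg := (hD h hh hc).trans hν
    rw [Finsupp.degree_eq_sum, Finsupp.degree_eq_sum,
      ← Finset.add_sum_erase _ _ (Finset.mem_univ (⟨0, hn⟩ : Fin n)),
      ← Finset.add_sum_erase _ (fun i => ν i) (Finset.mem_univ (⟨0, hn⟩ : Fin n)),
      Finset.sum_congr rfl (fun j hj' => (heq j (Finset.ne_of_mem_erase hj')))] at hdeg
    intro j
    by_cases hj0 : j = ⟨0, hn⟩
    · subst hj0; exact Nat.le_of_add_le_add_right hdeg
    · exact (heq j hj0).ge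
  · intro j
    by_cases hj0 : j = ⟨0, hn⟩
    · subst hj0; rw [cls_zero hn hc]; exact Nat.zero_le _
    · have := hle j
      simpa [Finsupp.single_apply, Ne.symm hj0] using this

theorem statement5 {n : ℕ} {K : Type*} [Field K] (hn : 0 < n) (m : MonomialOrder (Fin n))
    (hrev : IsRevLex m)
    (I : Ideal (MvPolynomial (Fin n) K)) (hI0 : I ≠ ⊥) (hIT : I ≠ ⊤) (hIhom : IsHomIdeal I)
    (H : Finset (MvPolynomial (Fin n) K)) (hPB : IsPB m H I) :
    satSet I = {f | ∃ s : ℕ, (X (⟨0, hn⟩ : Fin n)) ^ s * f ∈ I} ∧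
    (satSet I = (I : Set (MvPolynomial (Fin n) K)) ↔ ∀ h ∈ H, cls (ldeg m h) ≠ 0) := by
  have first : satSet I = {f | ∃ s : ℕ, (X (⟨0, hn⟩ : Fin n)) ^ s * f ∈ I} := by
    ext f
    constructor
    · rintro ⟨s, hs⟩
      exact ⟨s, hs _ (Ideal.pow_mem_pow (Ideal.subset_span (Set.mem_range_self _)) s)⟩
    · rintro ⟨s, hs⟩
      let D := H.sup fun h => (ldeg m h).degree
      refine ⟨D, fun g hg => ?_⟩
      refine key ⟨0, hn⟩ m I hIhom D (fun ν s h1 h2 =>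
        step hn m I H hPB D (fun h hh _ => Finset.le_sup (f := fun h => (ldeg m h).degree) hh)
          ν s h1 h2) s _ _ rfl ?_ ?_
      · have : g * f ∈ mxI n K ^ D := Ideal.mul_mem_right _ _ hg
        exact (mem_pow_idealOfVars_iff (σ := Fin n) (R := K) D _).1 this
      · have := I.mul_mem_left g hs
        convert! this using 1
        ring
  refine ⟨first, ?_, ?_⟩
  · intro hsat h hh hc
    obtain ⟨hHI, hH0, hinj, -, hspan, hinv⟩ := hPB
    have h0 := hH0 h hh
    obtain ⟨hg0, hgd⟩ := lead_comp m h0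
    have hgI := hom_mem hIhom (m.degree h).degree (hHI h hh)
    have hne : m.degree h ≠ 0 := by
      intro hd
      apply hIT
      have hC := m.eq_C_of_degree_eq_zero hd
      have hl := m.leadingCoeff_ne_zero_iff.2 h0
      apply Ideal.eq_top_of_isUnit_mem I (hHI h hh)
      rw [hC]
      exact (isUnit_iff_ne_zero.2 hl).map C
    have hpos : m.degree h ⟨0, hn⟩ ≠ 0 := by
      rcases Nat.sInf_eq_zero.1 hc with ⟨_, h'⟩ | h'
      · exact h'
      · exfalso
        apply hne
        ext j
        by_contra hj
        have : (j : ℕ) ∈ (∅ : Set ℕ) := h' ▸ ⟨j.2, hj⟩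
        exact this
    have hdvd : X (⟨0, hn⟩ : Fin n) ∣ homogeneousComponent (m.degree h).degree h := by
      rw [← Ideal.mem_span_singleton, ← Set.image_singleton, mem_ideal_span_X_image]
      intro ν hν
      refine ⟨_, rfl, ?_⟩
      have hle := m.le_degree hν
      rw [hgd] at hle
      have hνd : ν.degree = (m.degree h).degree := by
        rw [mem_support_iff, coeff_homogeneousComponent] at hν
        by_contra h
        simp [h] at hν
      rcases hle.lt_or_eq with hlt | heq
      · rcases (hrev _ _).1 hlt with h1 | ⟨-, i, hi, hij⟩
        · exact absurd hνd (ne_of_lt h1)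
        · by_cases hi0 : i = ⟨0, hn⟩
          · subst hi0; omega
          · rw [hij ⟨0, hn⟩ (by
              rw [Fin.lt_def]; simp only
              have : (i : ℕ) ≠ 0 := fun h => hi0 (Fin.ext h)
              omega)]
            exact hpos
      · rw [m.toSyn.injective heq]; exact hpos
    obtain ⟨f, hf⟩ := hdvd
    rw [hf] at hg0 hgd hgI
    have hfI : f ∈ I := by
      have : f ∈ satSet I := by
        rw [first]; exact ⟨1, by simpa using hgI⟩
      rw [hsat] at this
      exact this
    have hf0 : f ≠ 0 := right_ne_zero_of_mul hg0
    rw [m.degree_mul (left_ne_zero_of_mul hg0) hf0, m.degree_X] at hgd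
    obtain ⟨_, ⟨⟨h', hh', rfl⟩, hle, hj⟩, -⟩ :=
      hinv (m.degree f) ((mem_lt m I _).2 ⟨f, hfI, hf0, rfl⟩)
    simp only at hle hj
    have huniq := hinv (m.degree h) ((mem_lt m I _).2 ⟨h, hHI h hh, h0, rfl⟩)
    have e := huniq.unique (y₁ := ldeg m h') (y₂ := ldeg m h) ⟨⟨h', hh', rfl⟩, ?_, ?_⟩
      ⟨⟨h, hh, rfl⟩, le_rfl, fun j hj => absurd rfl hj⟩
    · have h1 := hle ⟨0, hn⟩
      rw [e, ldeg_eq, ← hgd] at h1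
      simp at h1
    · rw [← hgd]; exact hle.trans le_add_self
    · intro j hjne
      by_cases hj0 : j = ⟨0, hn⟩
      · subst hj0; exact Nat.zero_le _
      · apply hj
        rw [← hgd] at hjne
        simpa [Finsupp.single_apply, Ne.symm hj0] using hjne
  · intro hcls
    rw [first]
    ext f
    constructor
    · rintro ⟨s, hs⟩
      exact key ⟨0, hn⟩ m I hIhom 0 (fun ν s h1 h2 =>
        step hn m I H hPB 0 (fun h hh hc => absurd hc (hcls h hh)) ν s h1 h2) s _ _ rfl
        (fun _ _ => Nat.zero_le _) hs
    · intro hf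
      exact ⟨0, by simpa using hf⟩
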